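/- Let d ≥ 1, let f : ℝ^d → ℝ be differentiable with L-Lipschitz continuous gradient for some L > 0, let R : ℝ^d → ℝ be convex, and suppose F = f + R is bounded below by F_inf ∈ ℝ. Let 0 < α̃ ≤ α_max ≤ 1/(2L) and let (x_k)_{k∈ℕ} in ℝ^d, (g_k)_{k∈ℕ} in ℝ^d, and (α_k)_{k∈ℕ} in [α̃, α_max] be sequences such that for every k, x_{k+1} is a minimizer over ℝ^d of z ↦ R(z) + (1/(2α_k))‖z − (x_k − α_k g_k)‖², and such that ∑_{k=0}^∞ ‖∇f(x_k) − g_k‖² < ∞. Then every cluster point x̄ of the sequence (x_k) is a stationary point of F, i.e., R(y) ≥ R(x̄) − ⟨∇f(x̄), y − x̄⟩ for all y ∈ ℝ^d (equivalently, 0 ∈ ∇f(x̄) + ∂R(x̄)). -/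

import Mathlib

open Filter
open scoped RealInnerProductSpace

section

variable {E : Type*} [NormedAddCommGroup E] [InnerProductSpace ℝ E]

/-- A proximal point `p` of `w` with parameter `a` satisfies `(w - p) / a ∈ ∂R(p)`. -/
theorem ConvexOn.subgradient_of_proximal {R : E → ℝ} (hR : ConvexOn ℝ Set.univ R) {a : ℝ}
    {p w : E}
    (hp : ∀ z, R p + (1 / (2 * a)) * ‖p - w‖ ^ 2 ≤ R z + (1 / (2 * a)) * ‖z - w‖ ^ 2) (z : E) :
    R p + (1 / a) * ⟪w - p, z - p⟫ ≤ R z := by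
  have key : ∀ t ∈ Set.Ioo (0 : ℝ) 1,
      R p + (1 / a) * ⟪w - p, z - p⟫ ≤ R z + t * ((1 / (2 * a)) * ‖z - p‖ ^ 2) := by
    rintro t ⟨ht0, ht1⟩
    have h := hp ((1 - t) • p + t • z)
    have hc := hR.2 (Set.mem_univ p) (Set.mem_univ z) (sub_nonneg.2 ht1.le) ht0.le (by ring)
    have hn : ‖(1 - t) • p + t • z - w‖ ^ 2
        = ‖p - w‖ ^ 2 - 2 * t * ⟪w - p, z - p⟫ + t ^ 2 * ‖z - p‖ ^ 2 := by
      rw [show (1 - t) • p + t • z - w = t • (z - p) - (w - p) by module, norm_sub_sq_real,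
        norm_sub_rev p w, norm_smul, Real.norm_of_nonneg ht0.le, real_inner_smul_left,
        real_inner_comm]
      ring
    rw [hn] at h
    simp only [smul_eq_mul] at hc
    rw [show 1 / (2 * a) = (1 / a) / 2 by ring] at h ⊢
    refine le_of_mul_le_mul_left ?_ ht0
    linarith
  have hlim : Tendsto (fun t : ℝ => R z + t * ((1 / (2 * a)) * ‖z - p‖ ^ 2))
      (nhdsWithin 0 (Set.Ioi 0)) (nhds (R z)) := by
    have : Continuous fun t : ℝ => R z + t * ((1 / (2 * a)) * ‖z - p‖ ^ 2) := by fun_prop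
    simpa using (this.tendsto 0).mono_left nhdsWithin_le_nhds
  exact ge_of_tendsto hlim (eventually_of_mem (Ioo_mem_nhdsGT one_pos) key)

/-- A (non-sharp) descent lemma. -/
theorem Differentiable.le_add_inner_gradient_add_of_lipschitz [CompleteSpace E] {f : E → ℝ}
    (hf : Differentiable ℝ f) {L : ℝ} (hL : 0 ≤ L)
    (hlip : ∀ u v, ‖gradient f u - gradient f v‖ ≤ L * ‖u - v‖) (u v : E) :
    f v ≤ f u + ⟪gradient f u, v - u⟫ + L * ‖v - u‖ ^ 2 := by
  obtain ⟨c, hc, hfc⟩ := domain_mvt (s := Set.univ) (f := f) (f' := fderiv ℝ f)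
    (fun z _ => (hf z).hasFDerivAt.hasFDerivWithinAt) convex_univ (Set.mem_univ u)
    (Set.mem_univ v)
  have hg : fderiv ℝ f c (v - u) = ⟪gradient f c, v - u⟫ := by
    simp [gradient]
  have hcu : ‖c - u‖ ≤ ‖v - u‖ := by
    have := norm_sub_le_of_mem_segment hc
    simpa [norm_sub_rev] using this
  have hbound : ⟪gradient f c - gradient f u, v - u⟫ ≤ L * ‖v - u‖ ^ 2 :=
    calc ⟪gradient f c - gradient f u, v - u⟫
        ≤ ‖gradient f c - gradient f u‖ * ‖v - u‖ := real_inner_le_norm _ _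
      _ ≤ L * ‖v - u‖ * ‖v - u‖ := by
          gcongr
          exact (hlip c u).trans (by gcongr)
      _ = L * ‖v - u‖ ^ 2 := by ring
  rw [inner_sub_left] at hbound
  linarith

/-- Sufficient decrease of `f + R` in an inexact forward–backward step with gradient
estimate `g`. -/
theorem forwardBackward_sufficient_decrease [CompleteSpace E] {f R : E → ℝ}
    (hf : Differentiable ℝ f) {L : ℝ} (hL : 0 < L)
    (hlip : ∀ u v, ‖gradient f u - gradient f v‖ ≤ L * ‖u - v‖) {a : ℝ} (ha : 0 < a)
    (haL : a ≤ 1 / (2 * L)) {u p g : E}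
    (hsub : R p + (1 / a) * ⟪u - a • g - p, u - p⟫ ≤ R u) :
    L / 2 * ‖p - u‖ ^ 2
      ≤ (f u + R u) - (f p + R p) + 1 / (2 * L) * ‖gradient f u - g‖ ^ 2 := by
  have hdesc := hf.le_add_inner_gradient_add_of_lipschitz hL.le hlip u p
  have hexp : (1 / a) * ⟪u - a • g - p, u - p⟫ = (1 / a) * ‖p - u‖ ^ 2 + ⟪g, p - u⟫ := by
    rw [show u - a • g - p = -(p - u) - a • g by abel, ← neg_sub p u, inner_sub_left,
      inner_neg_neg, real_inner_self_eq_norm_sq, inner_neg_right, real_inner_smul_left]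
    field_simp
    ring
  have hinv : 2 * L ≤ 1 / a := by
    rw [le_div_iff₀ (by positivity)] at haL ⊢
    linarith
  have hs := mul_le_mul_of_nonneg_right hinv (sq_nonneg ‖p - u‖)
  have hcs : ⟪gradient f u - g, p - u⟫ ≤ ‖gradient f u - g‖ * ‖p - u‖ := real_inner_le_norm _ _
  have hyoung : ‖gradient f u - g‖ * ‖p - u‖
      ≤ 1 / (2 * L) * ‖gradient f u - g‖ ^ 2 + L / 2 * ‖p - u‖ ^ 2 := by
    have : 1 / (2 * L) * ‖gradient f u - g‖ ^ 2 + L / 2 * ‖p - u‖ ^ 2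
        - ‖gradient f u - g‖ * ‖p - u‖
        = 1 / (2 * L) * (‖gradient f u - g‖ - L * ‖p - u‖) ^ 2 := by
      field_simp
      ring
    have : 0 ≤ 1 / (2 * L) * (‖gradient f u - g‖ - L * ‖p - u‖) ^ 2 := by positivity
    linarith
  rw [inner_sub_left] at hcs
  linarith

end

/-- Deterministic (pathwise) FB–LISA convergence: if the squared gradient errors are
summable along the inexact forward–backward iteration with step sizes in `[α̃, α_max]`,
`α_max ≤ 1/(2L)`, then every cluster point `x̄` of `(xₖ)` is stationary for `F = f + R`,
i.e. `R(y) ≥ R(x̄) − ⟨∇f(x̄), y − x̄⟩` for all `y`. -/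
theorem stmt9 {d : ℕ} (hd : 1 ≤ d)
    (f R : EuclideanSpace ℝ (Fin d) → ℝ) (L : ℝ) (hL : 0 < L)
    (hf : Differentiable ℝ f)
    (hlip : ∀ u v, ‖gradient f u - gradient f v‖ ≤ L * ‖u - v‖)
    (hR : ConvexOn ℝ Set.univ R)
    (Finf : ℝ) (hbdd : ∀ z, Finf ≤ f z + R z)
    (αtil αmax : ℝ) (hαtil : 0 < αtil) (h1 : αtil ≤ αmax) (h2 : αmax ≤ 1 / (2 * L))
    (x g : ℕ → EuclideanSpace ℝ (Fin d)) (α : ℕ → ℝ)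
    (hα : ∀ k, αtil ≤ α k ∧ α k ≤ αmax)
    (hstep : ∀ k, ∀ z,
      R (x (k + 1)) + (1 / (2 * α k)) * ‖x (k + 1) - (x k - α k • g k)‖ ^ 2
        ≤ R z + (1 / (2 * α k)) * ‖z - (x k - α k • g k)‖ ^ 2)
    (herr : Summable (fun k => ‖gradient f (x k) - g k‖ ^ 2)) :
    ∀ xbar, MapClusterPt xbar atTop x →
      ∀ y, R y ≥ R xbar - ⟪gradient f xbar, y - xbar⟫ := by
  have hα0 : ∀ k, 0 < α k := fun k => hαtil.trans_le (hα k).1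
  have hsub : ∀ k z, R (x (k + 1)) + (1 / α k) * ⟪x k - α k • g k - x (k + 1), z - x (k + 1)⟫
      ≤ R z := fun k => hR.subgradient_of_proximal (hstep k)
  have hdec : ∀ k, L / 2 * ‖x (k + 1) - x k‖ ^ 2 ≤ (f (x k) + R (x k))
      - (f (x (k + 1)) + R (x (k + 1))) + 1 / (2 * L) * ‖gradient f (x k) - g k‖ ^ 2 := fun k =>
    forwardBackward_sufficient_decrease hf hL hlip (hα0 k) ((hα k).2.trans h2) (hsub k (x k))
  have hsum : Summable fun k => L / 2 * ‖x (k + 1) - x k‖ ^ 2 := by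
    refine summable_of_sum_range_le (c := f (x 0) + R (x 0) - Finf
      + 1 / (2 * L) * ∑' k, ‖gradient f (x k) - g k‖ ^ 2) (fun k => by positivity) fun n => ?_
    calc ∑ k ∈ Finset.range n, L / 2 * ‖x (k + 1) - x k‖ ^ 2
        ≤ ∑ k ∈ Finset.range n, ((f (x k) + R (x k)) - (f (x (k + 1)) + R (x (k + 1)))
            + 1 / (2 * L) * ‖gradient f (x k) - g k‖ ^ 2) := Finset.sum_le_sum fun k _ => hdec k
      _ = (f (x 0) + R (x 0)) - (f (x n) + R (x n))
            + 1 / (2 * L) * ∑ k ∈ Finset.range n, ‖gradient f (x k) - g k‖ ^ 2 := by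
          rw [Finset.sum_add_distrib, Finset.sum_range_sub' fun k => f (x k) + R (x k),
            Finset.mul_sum]
      _ ≤ _ := by
          gcongr
          · exact hbdd _
          · exact herr.sum_le_tsum _ fun k _ => by positivity
  have tendsto_zero {v : ℕ → EuclideanSpace ℝ (Fin d)}
      (hv : Tendsto (fun k => ‖v k‖ ^ 2) atTop (nhds 0)) : Tendsto v atTop (nhds 0) := by
    rw [tendsto_zero_iff_norm_tendsto_zero]
    simpa using hv.sqrt
  have hs : Tendsto (fun k => x (k + 1) - x k) atTop (nhds 0) := by
    refine tendsto_zero ?_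
    simpa [hL.ne'] using ((summable_mul_left_iff (half_pos hL).ne').1 hsum).tendsto_atTop_zero
  have he : Tendsto (fun k => gradient f (x k) - g k) atTop (nhds 0) :=
    tendsto_zero herr.tendsto_atTop_zero
  intro xbar hx y
  obtain ⟨U, hU, hxU⟩ := mapClusterPt_iff_ultrafilter.1 hx
  replace hs := hs.mono_left hU
  replace he := he.mono_left hU
  have hx1 : Tendsto (fun k => x (k + 1)) U (nhds xbar) := by
    simpa using hs.add hxU
  have hgrad : Continuous (gradient f) :=
    (LipschitzWith.of_dist_le_mul (K := L.toNNReal) fun u v => by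
      simpa [dist_eq_norm, hL.le] using hlip u v).continuous
  have hg : Tendsto g U (nhds (gradient f xbar)) := by
    simpa using ((hgrad.tendsto xbar).comp hxU).sub he
  have hRc : Continuous R := hR.locallyLipschitz.continuous
  have hlim : Tendsto (fun k => R (x (k + 1)) - ⟪g k, y - x (k + 1)⟫
      - 1 / αtil * (‖x (k + 1) - x k‖ * ‖y - x (k + 1)‖)) U
      (nhds (R xbar - ⟪gradient f xbar, y - xbar⟫)) := by
    have hy : Tendsto (fun k => y - x (k + 1)) U (nhds (y - xbar)) := hx1.const_sub y
    simpa using (((hRc.tendsto xbar).comp hx1).sub (hg.inner hy)).sub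
      ((hs.norm.mul hy.norm).const_mul (1 / αtil))
  refine le_of_tendsto hlim (Eventually.of_forall fun k => ?_)
  refine le_trans ?_ (hsub k y)
  have hexp : (1 / α k) * ⟪x k - α k • g k - x (k + 1), y - x (k + 1)⟫
      = -((1 / α k) * ⟪x (k + 1) - x k, y - x (k + 1)⟫) - ⟪g k, y - x (k + 1)⟫ := by
    rw [show x k - α k • g k - x (k + 1) = -(x (k + 1) - x k) - α k • g k by abel,
      inner_sub_left, inner_neg_left, real_inner_smul_left]
    have := (hα0 k).ne'
    field_simp
  have hbound : (1 / α k) * ⟪x (k + 1) - x k, y - x (k + 1)⟫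
      ≤ 1 / αtil * (‖x (k + 1) - x k‖ * ‖y - x (k + 1)‖) :=
    (mul_le_mul_of_nonneg_left (real_inner_le_norm _ _) (one_div_pos.2 (hα0 k)).le).trans
      (mul_le_mul_of_nonneg_right (one_div_le_one_div_of_le hαtil (hα k).1) (by positivity))
  linarith
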